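/- Let n ≥ 1, 0 < α < 2n, 1 < p₁, p₂ < ∞. There is a constant C depending only on n, α, p₁, p₂ such that: whenever b ∈ BMO(ℝⁿ) with ‖b‖_* = 1, Q is a cube with center x_Q, f_i(y) = |Q|^{−1/p_i}(sgn(b(y) − b_Q) − c₀) χ_Q(y) for i = 1,2 with c₀ = |Q|⁻¹ ∫_Q sgn(b(y) − b_Q) dy, and x ∈ (2√n Q)^c, then |I_α((b − b_Q) f₁, (b − b_Q) f₂)(x)| ≤ C |Q|^{1/p₁' + 1/p₂'} |x − x_Q|^{−2n + α}, where 1/p_i' = 1 − 1/p_i. -/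

import Mathlib

open MeasureTheory Filter
open scoped ENNReal Topology

noncomputable section

/-- Euclidean space `ℝⁿ`. -/
abbrev Rn (n : ℕ) := EuclideanSpace ℝ (Fin n)

/-- Axis-parallel closed cube with center `c` and side length `r`. -/
def cube (n : ℕ) (c : Rn n) (r : ℝ) : Set (Rn n) := {y | ∀ i, |y i - c i| ≤ r / 2}

/-- Average of `b` over a set `Q`. -/
def avg (n : ℕ) (b : Rn n → ℝ) (Q : Set (Rn n)) : ℝ :=
  (volume Q).toReal⁻¹ * ∫ x in Q, b x

/-- Mean oscillation of `b` over a set `Q`. -/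
def osc (n : ℕ) (b : Rn n → ℝ) (Q : Set (Rn n)) : ℝ :=
  (volume Q).toReal⁻¹ * ∫ x in Q, |b x - avg n b Q|

/-- The BMO seminorm `‖b‖_*`, as an extended real number (supremum of the mean
oscillations over all cubes). -/
def bmoNorm (n : ℕ) (b : Rn n → ℝ) : ℝ≥0∞ :=
  ⨆ (c : Rn n) (r : {r : ℝ // 0 < r}), ENNReal.ofReal (osc n b (cube n c r.1))

/-- `b ∈ BMO(ℝⁿ)`. -/
def MemBMO (n : ℕ) (b : Rn n → ℝ) : Prop :=
  LocallyIntegrable b volume ∧ bmoNorm n b < ⊤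

/-- `b ∈ CMO(ℝⁿ)`: `b` lies in the closure of `C_c^∞(ℝⁿ)` in the BMO seminorm. -/
def MemCMO (n : ℕ) (b : Rn n → ℝ) : Prop :=
  LocallyIntegrable b volume ∧
  ∀ ε : ℝ, 0 < ε → ∃ g : Rn n → ℝ, ContDiff ℝ (⊤ : ℕ∞) g ∧ HasCompactSupport g ∧
    bmoNorm n (fun x => b x - g x) ≤ ENNReal.ofReal ε

/-- The bilinear fractional integral operator `B_α`. -/
def Bop (n : ℕ) (α : ℝ) (f g : Rn n → ℝ) (x : Rn n) : ℝ :=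
  ∫ y, f (x - y) * g (x + y) * ‖y‖ ^ (α - n)

/-- The first commutator `[b, B_α]₁`. -/
def commB (n : ℕ) (α : ℝ) (b f g : Rn n → ℝ) (x : Rn n) : ℝ :=
  ∫ y, (b x - b y) * f y * g ((2 : ℝ) • x - y) * ‖x - y‖ ^ (α - n)

/-- The bilinear fractional integral operator `I_α`. -/
def Iop (n : ℕ) (α : ℝ) (f₁ f₂ : Rn n → ℝ) (x : Rn n) : ℝ :=
  ∫ y₁, ∫ y₂, f₁ y₁ * f₂ y₂ * (‖x - y₁‖ ^ 2 + ‖x - y₂‖ ^ 2) ^ (α / 2 - n)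

/-- The iterated commutator `[Πb⃗, I_α]` with `b⃗ = (b, b)`. -/
def commI (n : ℕ) (α : ℝ) (b f₁ f₂ : Rn n → ℝ) (x : Rn n) : ℝ :=
  ∫ y₁, ∫ y₂, (b x - b y₁) * (b x - b y₂) * f₁ y₁ * f₂ y₂ *
    (‖x - y₁‖ ^ 2 + ‖x - y₂‖ ^ 2) ^ (α / 2 - n)

/-- The Muckenhoupt class `A_p`. -/
def MemAp (n : ℕ) (p : ℝ) (w : Rn n → ℝ) : Prop :=
  ∃ C : ℝ, ∀ (c : Rn n) (r : ℝ), 0 < r →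
    ((volume (cube n c r)).toReal⁻¹ * ∫ x in cube n c r, w x) *
      ((volume (cube n c r)).toReal⁻¹ * ∫ x in cube n c r, w x ^ (-(1 / (p - 1)))) ^ (p - 1) ≤ C

/-- The bilinear weight class `A_{P,q}` with `P = (p₁, p₂)`. -/
def MemAPq (n : ℕ) (p₁ p₂ q : ℝ) (w₁ w₂ : Rn n → ℝ) : Prop :=
  ∃ C : ℝ, ∀ (c : Rn n) (r : ℝ), 0 < r →
    ((volume (cube n c r)).toReal⁻¹ * ∫ x in cube n c r, w₁ x ^ q * w₂ x ^ q) *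
      ((volume (cube n c r)).toReal⁻¹ *
          ∫ x in cube n c r, w₁ x ^ (-(1 - 1 / p₁)⁻¹)) ^ (q * (1 - 1 / p₁)) *
      ((volume (cube n c r)).toReal⁻¹ *
          ∫ x in cube n c r, w₂ x ^ (-(1 - 1 / p₂)⁻¹)) ^ (q * (1 - 1 / p₂)) ≤ C

theorem isClosed_cube (n : ℕ) (c : Rn n) (r : ℝ) : IsClosed (cube n c r) := by
  have h : cube n c r = ⋂ i, {y : Rn n | |y i - c i| ≤ r / 2} := by
    ext y
    simp [cube]
  rw [h]
  exact isClosed_iInter fun i => isClosed_le (by fun_prop) continuous_const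

theorem norm_sub_le_of_mem_cube {n : ℕ} {c y : Rn n} {r : ℝ} (hr : 0 ≤ r)
    (hy : y ∈ cube n c r) : ‖y - c‖ ≤ Real.sqrt n * r / 2 := by
  have h : ‖y - c‖ ^ 2 ≤ (Real.sqrt n * r / 2) ^ 2 := by
    rw [EuclideanSpace.norm_sq_eq]
    calc ∑ i, ‖(y - c) i‖ ^ 2 ≤ ∑ _i : Fin n, (r / 2) ^ 2 := by
          refine Finset.sum_le_sum fun i _ => ?_
          exact pow_le_pow_left₀ (norm_nonneg _) (by simpa using hy i) 2
      _ = (Real.sqrt n * r / 2) ^ 2 := by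
          rw [Finset.sum_const, Finset.card_univ, Fintype.card_fin, nsmul_eq_mul, mul_div_assoc,
            mul_pow, Real.sq_sqrt (Nat.cast_nonneg n)]
  exact le_of_sq_le_sq h (by positivity)

theorem half_lt_norm_sub_of_notMem_cube {n : ℕ} {c x : Rn n} {r : ℝ}
    (hx : x ∉ cube n c r) : r / 2 < ‖x - c‖ := by
  simp only [cube, Set.mem_ofPred_eq, not_forall, not_le] at hx
  obtain ⟨i, hi⟩ := hx
  exact hi.trans_le (by simpa using PiLp.norm_apply_le (x - c) i)

theorem isCompact_cube (n : ℕ) (c : Rn n) {r : ℝ} (hr : 0 ≤ r) : IsCompact (cube n c r) :=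
  (isCompact_closedBall c (Real.sqrt n * r / 2)).of_isClosed_subset (isClosed_cube n c r)
    fun y hy => by
      rw [Metric.mem_closedBall, dist_eq_norm]
      exact norm_sub_le_of_mem_cube hr hy

theorem volume_cube_toReal_pos (n : ℕ) (c : Rn n) {r : ℝ} (hr : 0 < r) :
    0 < (volume (cube n c r)).toReal := by
  refine ENNReal.toReal_pos (ne_of_gt ?_) (isCompact_cube n c hr.le).measure_ne_top
  refine (Metric.measure_ball_pos volume c (half_pos hr)).trans_le (measure_mono fun y hy => ?_)
  by_contra h
  rw [Metric.mem_ball, dist_eq_norm] at hy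
  exact (half_lt_norm_sub_of_notMem_cube h).not_gt hy

theorem osc_le_one {n : ℕ} {b : Rn n → ℝ} (hb : bmoNorm n b ≤ 1) (c : Rn n) {r : ℝ}
    (hr : 0 < r) : osc n b (cube n c r) ≤ 1 := by
  rw [← ENNReal.ofReal_le_one]
  exact (le_iSup₂ (f := fun (c : Rn n) (r : {r : ℝ // 0 < r}) =>
    ENNReal.ofReal (osc n b (cube n c r.1))) c ⟨r, hr⟩).trans hb

theorem kernel_le {n : ℕ} {α : ℝ} (hαn : α ≤ 2 * n) {c x y z : Rn n} {r : ℝ} (hr : 0 < r)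
    (hn : 1 ≤ n) (hx : x ∉ cube n c (2 * Real.sqrt n * r)) (hy : y ∈ cube n c r)
    (hz : z ∈ cube n c r) :
    (‖x - y‖ ^ 2 + ‖x - z‖ ^ 2) ^ (α / 2 - n) ≤
      2 ^ (n - α / 2) * ‖x - c‖ ^ (-(2 * n) + α) := by
  have hx' := half_lt_norm_sub_of_notMem_cube hx
  have hn' : 0 < Real.sqrt n := Real.sqrt_pos.2 (by exact_mod_cast hn)
  have hpos : 0 < ‖x - c‖ := lt_of_le_of_lt (by positivity) hx'
  have half_le : ∀ w ∈ cube n c r, ‖x - c‖ / 2 ≤ ‖x - w‖ := fun w hw => by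
    have h₁ := norm_sub_le_of_mem_cube hr.le hw
    have h₂ := norm_sub_le_norm_sub_add_norm_sub x w c
    linarith
  have hbase : ‖x - c‖ ^ 2 / 2 ≤ ‖x - y‖ ^ 2 + ‖x - z‖ ^ 2 := by
    have h₁ := pow_le_pow_left₀ (by positivity) (half_le y hy) 2
    have h₂ := pow_le_pow_left₀ (by positivity) (half_le z hz) 2
    linarith
  refine (Real.rpow_le_rpow_of_nonpos (by positivity) hbase (by linarith)).trans_eq ?_
  rw [Real.div_rpow (by positivity) (by norm_num), ← Real.rpow_natCast, ← Real.rpow_mul hpos.le,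
    div_eq_mul_inv, ← Real.rpow_neg (by norm_num), mul_comm]
  congr 2 <;> push_cast <;> ring

theorem abs_Iop_le {n : ℕ} {α K : ℝ} {f₁ f₂ g₁ g₂ : Rn n → ℝ} {x : Rn n} {s : Set (Rn n)}
    (hg₁ : Integrable g₁) (hg₂ : Integrable g₂) (h₁ : ∀ y, |f₁ y| ≤ g₁ y)
    (h₂ : ∀ y, |f₂ y| ≤ g₂ y) (hf₁ : ∀ y, y ∉ s → f₁ y = 0) (hf₂ : ∀ y, y ∉ s → f₂ y = 0)
    (hK₀ : 0 ≤ K)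
    (hK : ∀ y ∈ s, ∀ z ∈ s, (‖x - y‖ ^ 2 + ‖x - z‖ ^ 2) ^ (α / 2 - n) ≤ K) :
    |Iop n α f₁ f₂ x| ≤ K * (∫ y, g₁ y) * ∫ y, g₂ y := by
  have hbound : ∀ y z, ‖f₁ y * f₂ z * (‖x - y‖ ^ 2 + ‖x - z‖ ^ 2) ^ (α / 2 - n)‖ ≤
      K * g₁ y * g₂ z := fun y z => by
    have hy := (abs_nonneg _).trans (h₁ y)
    have hz := (abs_nonneg _).trans (h₂ z)
    by_cases hys : y ∈ s
    · by_cases hzs : z ∈ s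
      · rw [norm_mul, norm_mul, Real.norm_eq_abs, Real.norm_eq_abs, Real.norm_eq_abs,
          abs_of_nonneg (a := _ ^ _) (by positivity)]
        calc _ ≤ g₁ y * g₂ z * K := by
              gcongr
              exacts [h₁ y, h₂ z, hK y hys z hzs]
          _ = _ := by ring
      · simp only [hf₂ z hzs, mul_zero, zero_mul, norm_zero]
        positivity
    · simp only [hf₁ y hys, zero_mul, norm_zero]
      positivity
  have hinner : ∀ y, ‖∫ z, f₁ y * f₂ z * (‖x - y‖ ^ 2 + ‖x - z‖ ^ 2) ^ (α / 2 - n)‖ ≤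
      K * g₁ y * ∫ z, g₂ z := fun y => by
    rw [← integral_const_mul]
    exact norm_integral_le_of_norm_le (hg₂.const_mul _) (.of_forall (hbound y))
  rw [Iop, ← Real.norm_eq_abs, ← integral_const_mul K, ← integral_mul_const]
  exact norm_integral_le_of_norm_le ((hg₁.const_mul K).mul_const _) (.of_forall hinner)

theorem abs_sign_le_one (t : ℝ) : |Real.sign t| ≤ 1 := by
  rcases Real.sign_apply_eq t with h | h | h <;> simp [h]

theorem abs_sign_sub_avg_sign_le_two {n : ℕ} (c : Rn n) {r : ℝ} (hr : 0 < r) (g : Rn n → ℝ)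
    (t : ℝ) :
    |Real.sign t - (volume (cube n c r)).toReal⁻¹ * ∫ z in cube n c r, Real.sign (g z)| ≤ 2 := by
  have hV := volume_cube_toReal_pos n c hr
  have h : |∫ z in cube n c r, Real.sign (g z)| ≤ 1 * (volume (cube n c r)).toReal := by
    rw [← Real.norm_eq_abs]
    exact norm_setIntegral_le_of_norm_le_const (isCompact_cube n c hr.le).measure_lt_top
      fun z _ => abs_sign_le_one (g z)
  have h' : |(volume (cube n c r)).toReal⁻¹ * ∫ z in cube n c r, Real.sign (g z)| ≤ 1 := by
    rw [abs_mul, abs_of_pos (inv_pos.2 hV), inv_mul_le_iff₀ hV]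
    linarith
  linarith [abs_sub (Real.sign t)
    ((volume (cube n c r)).toReal⁻¹ * ∫ z in cube n c r, Real.sign (g z)), abs_sign_le_one t]

theorem integrableOn_abs_sub_cube {n : ℕ} {b : Rn n → ℝ} (hb : LocallyIntegrable b volume)
    (c : Rn n) {r : ℝ} (hr : 0 ≤ r) (a : ℝ) :
    IntegrableOn (fun y => |b y - a|) (cube n c r) := by
  have hQ := isCompact_cube n c hr
  exact ((hb.integrableOn_isCompact hQ).sub (integrableOn_const hQ.measure_ne_top)).abs

theorem integral_indicator_le {n : ℕ} {b : Rn n → ℝ} (hb : bmoNorm n b ≤ 1) (c : Rn n) {r : ℝ}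
    (hr : 0 < r) (p : ℝ) :
    ∫ y, (cube n c r).indicator (fun y => 2 * (volume (cube n c r)).toReal ^ (-(1 / p)) *
      |b y - avg n b (cube n c r)|) y ≤ 2 * (volume (cube n c r)).toReal ^ (1 - 1 / p) := by
  have hV := volume_cube_toReal_pos n c hr
  have hosc := osc_le_one hb c hr
  rw [osc, inv_mul_le_iff₀ hV, mul_one] at hosc
  rw [integral_indicator (isClosed_cube n c r).measurableSet, integral_const_mul,
    sub_eq_neg_add 1, Real.rpow_add hV, Real.rpow_one, ← mul_assoc]
  gcongr

theorem abs_indicator_le {n : ℕ} (b : Rn n → ℝ) (c : Rn n) {r : ℝ} (hr : 0 < r) (p : ℝ)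
    (y : Rn n) :
    |(cube n c r).indicator (fun y =>
        (b y - avg n b (cube n c r)) *
          ((volume (cube n c r)).toReal ^ (-(1 / p)) *
            (Real.sign (b y - avg n b (cube n c r)) -
              (volume (cube n c r)).toReal⁻¹ *
                ∫ z in cube n c r, Real.sign (b z - avg n b (cube n c r))))) y| ≤
      (cube n c r).indicator (fun y => 2 * (volume (cube n c r)).toReal ^ (-(1 / p)) *
        |b y - avg n b (cube n c r)|) y := by
  by_cases hy : y ∈ cube n c r
  · rw [Set.indicator_of_mem hy, Set.indicator_of_mem hy, abs_mul, abs_mul,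
      abs_of_nonneg (a := _ ^ _) (by positivity)]
    calc _ ≤ |b y - avg n b (cube n c r)| * ((volume (cube n c r)).toReal ^ (-(1 / p)) * 2) := by
          gcongr
          exact abs_sign_sub_avg_sign_le_two c hr (fun z => b z - avg n b (cube n c r)) _
      _ = _ := by ring
  · simp [Set.indicator_of_notMem hy]

/-- pointwise upper bound `|I_α((b-b_Q)f₁, (b-b_Q)f₂)(x)| ≲
|Q|^{1/p₁'+1/p₂'} |x - x_Q|^{-2n+α}` for `x ∈ (2√n Q)^c`. -/
theorem statement10 (n : ℕ) (hn : 1 ≤ n) (α p₁ p₂ : ℝ)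
    (hα : 0 < α) (hαn : α < 2 * n) (hp₁ : 1 < p₁) (hp₂ : 1 < p₂) :
    ∃ C : ℝ, ∀ (b : Rn n → ℝ) (c : Rn n) (r : ℝ), 0 < r →
      LocallyIntegrable b volume → bmoNorm n b = 1 →
      ∀ x : Rn n, x ∉ cube n c (2 * Real.sqrt n * r) →
        |Iop n α
            ((cube n c r).indicator fun y =>
              (b y - avg n b (cube n c r)) *
                ((volume (cube n c r)).toReal ^ (-(1 / p₁)) *
                  (Real.sign (b y - avg n b (cube n c r)) -
                    (volume (cube n c r)).toReal⁻¹ *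
                      ∫ z in cube n c r, Real.sign (b z - avg n b (cube n c r)))))
            ((cube n c r).indicator fun y =>
              (b y - avg n b (cube n c r)) *
                ((volume (cube n c r)).toReal ^ (-(1 / p₂)) *
                  (Real.sign (b y - avg n b (cube n c r)) -
                    (volume (cube n c r)).toReal⁻¹ *
                      ∫ z in cube n c r, Real.sign (b z - avg n b (cube n c r)))))
            x| ≤
          C * (volume (cube n c r)).toReal ^ ((1 - 1 / p₁) + (1 - 1 / p₂)) *
            ‖x - c‖ ^ (-(2 * n) + α) := by
  refine ⟨2 ^ (n - α / 2) * 4, fun b c r hr hb hnorm x hx => ?_⟩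
  have hV := volume_cube_toReal_pos n c hr
  have hint : ∀ p : ℝ, Integrable ((cube n c r).indicator fun y =>
      2 * (volume (cube n c r)).toReal ^ (-(1 / p)) * |b y - avg n b (cube n c r)|) := fun p =>
    IntegrableOn.integrable_indicator ((integrableOn_abs_sub_cube hb c hr.le _).const_mul _)
      (isClosed_cube n c r).measurableSet
  refine (abs_Iop_le (s := cube n c r) (hint p₁) (hint p₂) (abs_indicator_le b c hr p₁)
    (abs_indicator_le b c hr p₂) (fun y hy => Set.indicator_of_notMem hy _)
    (fun y hy => Set.indicator_of_notMem hy _) (by positivity)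
    fun y hy z hz => kernel_le hαn.le hr hn hx hy hz).trans ?_
  have h₁ := integral_indicator_le hnorm.le c hr p₁
  have h₂ := integral_indicator_le hnorm.le c hr p₂
  have h₀ : 0 ≤ ∫ y, (cube n c r).indicator (fun y =>
      2 * (volume (cube n c r)).toReal ^ (-(1 / p₂)) * |b y - avg n b (cube n c r)|) y :=
    integral_nonneg fun y => Set.indicator_nonneg (fun _ _ => by positivity) y
  calc _ ≤ 2 ^ (n - α / 2) * ‖x - c‖ ^ (-(2 * n) + α) *
        (2 * (volume (cube n c r)).toReal ^ (1 - 1 / p₁)) *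
        (2 * (volume (cube n c r)).toReal ^ (1 - 1 / p₂)) := by gcongr
    _ = _ := by
      rw [Real.rpow_add hV]
      ring
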